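/- arXiv:2206.10220 — 8 statements merged into one kernel-verified Lean document; each statement's English description precedes it below -/
import Mathlib

section
/- Let μ ∈ ℂ. If μ ∈ S_GRE, then μ ∈ S_LMM. That is, S_GRE ⊆ S_LMM. -/
/-- Region of absolute stability of a `k`-step linear multistep method with
coefficients `a j` (the `α_j`) and `b j` (the `β_j`): the set of `μ ∈ ℂ` with
`α_k − μ β_k ≠ 0` such that every solution of the recurrence
`∑_{j=0}^k (α_j − μ β_j) y_{n+j} = 0` is bounded. -/
def SLMM (k : ℕ) (a b : ℕ → ℝ) : Set ℂ :=
  {μ : ℂ | (a k : ℂ) - μ * (b k : ℂ) ≠ 0 ∧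
    ∀ y : ℕ → ℂ,
      (∀ n : ℕ, ∑ j ∈ Finset.range (k + 1), ((a j : ℂ) - μ * (b j : ℂ)) * y (n + j) = 0) →
      ∃ M : ℝ, ∀ n : ℕ, ‖y n‖ ≤ M}

/-- Region of absolute stability of the LMM-GRE (global Richardson extrapolation)
method of order `p` built on the underlying `k`-step LMM: the set of `μ ∈ ℂ` with
`α_k − μ β_k ≠ 0` and `α_k − (μ/2) β_k ≠ 0` such that for all solutions `y` of the
recurrence with parameter `μ` and all solutions `z` of the recurrence with parameter
`μ/2`, the extrapolated sequence `r_n = (2^p/(2^p−1))·z_{2n} − (1/(2^p−1))·y_n`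
is bounded. -/
def SGRE (k : ℕ) (a b : ℕ → ℝ) (p : ℕ) : Set ℂ :=
  {μ : ℂ | (a k : ℂ) - μ * (b k : ℂ) ≠ 0 ∧ (a k : ℂ) - (μ / 2) * (b k : ℂ) ≠ 0 ∧
    ∀ y z : ℕ → ℂ,
      (∀ n : ℕ, ∑ j ∈ Finset.range (k + 1), ((a j : ℂ) - μ * (b j : ℂ)) * y (n + j) = 0) →
      (∀ m : ℕ, ∑ j ∈ Finset.range (k + 1), ((a j : ℂ) - (μ / 2) * (b j : ℂ)) * z (m + j) = 0) →
      ∃ M : ℝ, ∀ n : ℕ,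
        ‖(2 ^ p / (2 ^ p - 1) : ℂ) * z (2 * n) - (1 / (2 ^ p - 1) : ℂ) * y n‖ ≤ M}

/-- **Lemma 2 (ii):** `S_GRE ⊆ S_LMM`: every point of the region of absolute
stability of the extrapolated method belongs to the region of absolute stability
of the underlying linear multistep method. -/
theorem SGRE_subset_SLMM
    (k : ℕ) (hk : 1 ≤ k) (a b : ℕ → ℝ) (hak : a k ≠ 0) (p : ℕ) (hp : 1 ≤ p)
    (μ : ℂ) (hμ : μ ∈ SGRE k a b p) :
    μ ∈ SLMM k a b := by
  obtain ⟨h1, _, h3⟩ := hμ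
  refine ⟨h1, fun y hy => ?_⟩
  obtain ⟨M, hM⟩ := h3 y (fun _ => 0) hy (by simp)
  have hc : (2 ^ p - 1 : ℂ) ≠ 0 := by
    intro h
    have h2 : ((2 ^ p : ℕ) : ℂ) = ((1 : ℕ) : ℂ) := by
      push_cast
      linear_combination h
    have h4 : 2 ^ p = 1 := Nat.cast_injective h2
    have h5 : 1 < 2 ^ p := Nat.one_lt_two_pow (by omega)
    omega
  refine ⟨‖(2 ^ p - 1 : ℂ)‖ * M, fun n => ?_⟩
  have e : y n = -((2 ^ p - 1 : ℂ) *
      ((2 ^ p / (2 ^ p - 1) : ℂ) * 0 - (1 / (2 ^ p - 1) : ℂ) * y n)) := by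
    field_simp
    ring
  rw [e, norm_neg, norm_mul]
  exact mul_le_mul_of_nonneg_left (hM n) (norm_nonneg _)
end

section
/- Assume that 0 ∈ S_LMM (this holds in particular when the underlying linear multistep method is zero-stable) and that S_LMM is a convex subset of ℂ. Then S_GRE = S_LMM. -/
/-- **Lemma 3:** if `0 ∈ S_LMM` (e.g. the underlying LMM is zero-stable) and
`S_LMM` is convex, then `S_GRE = S_LMM`. -/
theorem SGRE_eq_SLMM_of_convex
    (k : ℕ) (hk : 1 ≤ k) (a b : ℕ → ℝ) (hak : a k ≠ 0) (p : ℕ) (hp : 1 ≤ p)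
    (h0 : (0 : ℂ) ∈ SLMM k a b) (hconv : Convex ℝ (SLMM k a b)) :
    SGRE k a b p = SLMM k a b := by
  have hp2 : (2 ^ p - 1 : ℂ) ≠ 0 := by
    have h1 : (1 : ℝ) < 2 ^ p := one_lt_pow₀ (by norm_num) (by omega)
    have h2 : (2 ^ p - 1 : ℝ) ≠ 0 := by linarith
    exact_mod_cast h2
  ext μ
  constructor
  · rintro ⟨h1, _, h3⟩
    refine ⟨h1, fun y hy => ?_⟩
    obtain ⟨M, hM⟩ := h3 y (fun _ => 0) hy (by simp)
    refine ⟨‖(2 ^ p - 1 : ℂ)‖ * M, fun n => ?_⟩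
    have e : y n = -((2 ^ p - 1 : ℂ) *
        ((2 ^ p / (2 ^ p - 1) : ℂ) * 0 - (1 / (2 ^ p - 1) : ℂ) * y n)) := by
      field_simp
      ring
    rw [e, norm_neg, norm_mul]
    exact mul_le_mul_of_nonneg_left (hM n) (norm_nonneg _)
  · intro h
    have hh : μ / 2 ∈ SLMM k a b := by
      have h4 := hconv h0 h (a := 1 / 2) (b := 1 / 2) (by norm_num) (by norm_num) (by norm_num)
      have e : ((1 / 2 : ℝ) • (0 : ℂ) + (1 / 2 : ℝ) • μ) = μ / 2 := by
        rw [smul_zero, zero_add, Complex.real_smul]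
        push_cast
        ring
      rwa [e] at h4
    refine ⟨h.1, hh.1, fun y z hy hz => ?_⟩
    obtain ⟨A, hA⟩ := h.2 y hy
    obtain ⟨B, hB⟩ := hh.2 z hz
    refine ⟨‖(2 ^ p / (2 ^ p - 1) : ℂ)‖ * B + ‖(1 / (2 ^ p - 1) : ℂ)‖ * A, fun n => ?_⟩
    refine (norm_sub_le _ _).trans ?_
    rw [norm_mul, norm_mul]
    exact add_le_add (mul_le_mul_of_nonneg_left (hB _) (norm_nonneg _))
      (mul_le_mul_of_nonneg_left (hA _) (norm_nonneg _))
end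

section
/- Let α ∈ (0, π/2] and suppose that the open sector Σ_α := {μ ∈ ℂ : μ ≠ 0 and |arg(−μ)| < α} is contained in S_LMM (i.e., the underlying linear multistep method is A(α)-stable). Then Σ_α ⊆ S_GRE, i.e., the LMM-GRE method is also A(α)-stable with the same angle α. -/
/-- **A(α)-stability is preserved by global Richardson extrapolation:** if the open
sector `Σ_α = {μ ≠ 0 : |arg(−μ)| < α}` is contained in `S_LMM`, then it is also
contained in `S_GRE`. -/
theorem sector_subset_SGRE_of_sector_subset_SLMM
    (k : ℕ) (hk : 1 ≤ k) (a b : ℕ → ℝ) (hak : a k ≠ 0) (p : ℕ) (hp : 1 ≤ p)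
    (α : ℝ) (hα : α ∈ Set.Ioc 0 (Real.pi / 2))
    (hsec : {μ : ℂ | μ ≠ 0 ∧ |Complex.arg (-μ)| < α} ⊆ SLMM k a b) :
    {μ : ℂ | μ ≠ 0 ∧ |Complex.arg (-μ)| < α} ⊆ SGRE k a b p := by
  rintro μ ⟨hμ, harg⟩
  have h2 : μ / 2 ∈ {μ : ℂ | μ ≠ 0 ∧ |Complex.arg (-μ)| < α} := by
    refine ⟨div_ne_zero hμ two_ne_zero, ?_⟩
    have he : -(μ / 2) = ((1 / 2 : ℝ) : ℂ) * (-μ) := by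
      push_cast
      ring
    rw [he, Complex.arg_real_mul _ (by norm_num)]
    exact harg
  obtain ⟨h1a, h1b⟩ := hsec (show μ ∈ _ from ⟨hμ, harg⟩)
  obtain ⟨h2a, h2b⟩ := hsec h2
  refine ⟨h1a, h2a, fun y z hy hz => ?_⟩
  obtain ⟨M, hM⟩ := h1b y hy
  obtain ⟨N, hN⟩ := h2b z hz
  refine ⟨‖(2 ^ p / (2 ^ p - 1) : ℂ)‖ * N + ‖(1 / (2 ^ p - 1) : ℂ)‖ * M, fun n => ?_⟩
  refine (norm_sub_le _ _).trans ?_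
  rw [norm_mul, norm_mul]
  exact add_le_add (mul_le_mul_of_nonneg_left (hN _) (norm_nonneg _))
    (mul_le_mul_of_nonneg_left (hM _) (norm_nonneg _))
end

section
/- The BDF1-GRE (extrapolated implicit Euler) method is A-stable: for every μ ∈ ℂ with Re μ < 0, every complex sequence (y_n) satisfying (1 − μ)·y_{n+1} = y_n for all n, and every complex sequence (z_m) satisfying (1 − μ/2)·z_{m+1} = z_m for all m, the sequence r_n := 2·z_{2n} − y_n is bounded. -/
lemma bdf1_bound (w : ℂ) (hw : w.re < 0) (x : ℕ → ℂ)
    (hx : ∀ n : ℕ, (1 - w) * x (n + 1) = x n) (n : ℕ) : ‖x n‖ ≤ ‖x 0‖ := by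
  have h1 : 1 ≤ ‖1 - w‖ := by
    have h := Complex.re_le_norm (1 - w)
    simp only [Complex.sub_re, Complex.one_re] at h
    linarith
  induction n with
  | zero => exact le_refl _
  | succ k ih =>
    have h2 : ‖1 - w‖ * ‖x (k + 1)‖ = ‖x k‖ := by rw [← norm_mul, hx k]
    nlinarith [norm_nonneg (x (k + 1))]

/-- **A-stability of BDF1-GRE (extrapolated implicit Euler):** for every `μ ∈ ℂ`
with `Re μ < 0`, every solution `y` of `(1 − μ)·y_{n+1} = y_n` and every solution
`z` of `(1 − μ/2)·z_{m+1} = z_m`, the extrapolated sequence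
`r_n = 2·z_{2n} − y_n` is bounded. -/
theorem BDF1_GRE_A_stable
    (μ : ℂ) (hμ : μ.re < 0)
    (y z : ℕ → ℂ)
    (hy : ∀ n : ℕ, (1 - μ) * y (n + 1) = y n)
    (hz : ∀ m : ℕ, (1 - μ / 2) * z (m + 1) = z m) :
    ∃ M : ℝ, ∀ n : ℕ, ‖2 * z (2 * n) - y n‖ ≤ M := by
  have hμ2 : (μ / 2).re < 0 := by
    have h : (μ / 2).re = μ.re / 2 := by simp
    rw [h]
    linarith
  refine ⟨2 * ‖z 0‖ + ‖y 0‖, fun n => ?_⟩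
  have h1 := bdf1_bound μ hμ y hy n
  have h2 := bdf1_bound (μ / 2) hμ2 z hz (2 * n)
  have h3 := norm_sub_le (2 * z (2 * n)) (y n)
  have h4 : ‖2 * z (2 * n)‖ = 2 * ‖z (2 * n)‖ := by simp
  linarith
end

section
/- The BDF2-GRE method is A-stable (it is a third-order A-stable method): for every μ ∈ ℂ with Re μ < 0, every complex sequence (y_n) satisfying (3/2 − μ)·y_{n+2} − 2·y_{n+1} + (1/2)·y_n = 0 for all n, and every complex sequence (z_m) satisfying (3/2 − μ/2)·z_{m+2} − 2·z_{m+1} + (1/2)·z_m = 0 for all m, the sequence r_n := (4/3)·z_{2n} − (1/3)·y_n is bounded. -/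
/-- G-stability of BDF2: the energy decreases along solutions. -/
lemma bdf2_energy_step (μ a b c : ℂ) (hμ : μ.re < 0)
    (h : (3 / 2 - μ) * a - 2 * b + (1 / 2) * c = 0) :
    Complex.normSq a + Complex.normSq (2 * a - b) ≤
      Complex.normSq b + Complex.normSq (2 * b - c) := by
  have h1 : μ * a = (3 / 2 : ℝ) * a - (2 : ℝ) * b + (1 / 2 : ℝ) * c := by
    push_cast
    linear_combination -h
  have hre := congrArg Complex.re h1
  have him := congrArg Complex.im h1
  simp only [Complex.mul_re, Complex.mul_im, Complex.add_re, Complex.add_im, Complex.sub_re,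
    Complex.sub_im, Complex.ofReal_re, Complex.ofReal_im] at hre him
  have hneg : μ.re * (a.re ^ 2 + a.im ^ 2) ≤ 0 :=
    mul_nonpos_of_nonpos_of_nonneg hμ.le (by positivity)
  simp only [Complex.normSq_apply, Complex.mul_re, Complex.mul_im, Complex.sub_re,
    Complex.sub_im, Complex.re_ofNat, Complex.im_ofNat]
  linear_combination 4 * hneg - 4 * a.re * hre - 4 * a.im * him +
    sq_nonneg (a.re - 2 * b.re + c.re) + sq_nonneg (a.im - 2 * b.im + c.im)

lemma bdf2_bounded (μ : ℂ) (hμ : μ.re < 0) (y : ℕ → ℂ)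
    (hy : ∀ n : ℕ, (3 / 2 - μ) * y (n + 2) - 2 * y (n + 1) + (1 / 2) * y n = 0) :
    ∃ M : ℝ, ∀ n : ℕ, ‖y n‖ ≤ M := by
  set E : ℕ → ℝ := fun n =>
    Complex.normSq (y (n + 1)) + Complex.normSq (2 * y (n + 1) - y n) with hE
  have hanti : Antitone E :=
    antitone_nat_of_succ_le fun n => bdf2_energy_step μ _ _ _ hμ (hy n)
  refine ⟨‖y 0‖ + √(E 0), fun n => ?_⟩
  cases n with
  | zero => exact le_add_of_nonneg_right (Real.sqrt_nonneg _)
  | succ n =>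
    have h1 : ‖y (n + 1)‖ ^ 2 ≤ E 0 := by
      have h2 : E n ≤ E 0 := hanti (Nat.zero_le n)
      have h3 : 0 ≤ Complex.normSq (2 * y (n + 1) - y n) := Complex.normSq_nonneg _
      rw [← Complex.normSq_eq_norm_sq]
      simp only [hE] at h2 ⊢
      linarith
    have := Real.le_sqrt_of_sq_le h1
    linarith [norm_nonneg (y 0)]

/-- **A-stability of the third-order BDF2-GRE method:** for every `μ ∈ ℂ` with
`Re μ < 0`, every solution `y` of `(3/2 − μ)·y_{n+2} − 2·y_{n+1} + (1/2)·y_n = 0`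
and every solution `z` of the same recurrence with `μ/2` in place of `μ`,
the extrapolated sequence `r_n = (4/3)·z_{2n} − (1/3)·y_n` is bounded. -/
theorem BDF2_GRE_A_stable
    (μ : ℂ) (hμ : μ.re < 0)
    (y z : ℕ → ℂ)
    (hy : ∀ n : ℕ, (3 / 2 - μ) * y (n + 2) - 2 * y (n + 1) + (1 / 2) * y n = 0)
    (hz : ∀ m : ℕ, (3 / 2 - μ / 2) * z (m + 2) - 2 * z (m + 1) + (1 / 2) * z m = 0) :
    ∃ M : ℝ, ∀ n : ℕ, ‖(4 / 3 : ℂ) * z (2 * n) - (1 / 3 : ℂ) * y n‖ ≤ M := by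
  obtain ⟨A, hA⟩ := bdf2_bounded μ hμ y hy
  obtain ⟨B, hB⟩ := bdf2_bounded (μ / 2) (by simp; linarith) z hz
  refine ⟨4 / 3 * B + 1 / 3 * A, fun n => ?_⟩
  refine (norm_sub_le _ _).trans ?_
  rw [norm_mul, norm_mul]
  have h1 : ‖(4 / 3 : ℂ)‖ = 4 / 3 := by norm_num
  have h2 : ‖(1 / 3 : ℂ)‖ = 1 / 3 := by norm_num
  rw [h1, h2]
  linarith [hA n, hB (2 * n)]
end

section
/- The region of absolute stability of the 2-step Adams–Bashforth method, namely the set S := {μ ∈ ℂ : every complex sequence (y_n) satisfying y_{n+2} − (1 + (3/2)μ)·y_{n+1} + (μ/2)·y_n = 0 for all n is bounded}, is a convex subset of ℂ. -/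
/-- Schur–Cohn identity, in real coordinates. -/
lemma AB2_identity (a b c d p q : ℝ) (hp : p = a * c - b * d) (hq : q = a * d + b * c)
    (hs : a + c = 1 + 3 * p) (ht : b + d = 3 * q) :
    (1 - (a ^ 2 + b ^ 2)) * (1 - (c ^ 2 + d ^ 2)) *
      ((1 - (a * c + b * d)) ^ 2 + (a * d - b * c) ^ 2) =
    -8 * (p ^ 2 + q ^ 2) ^ 2 - 4 * p + 12 * p * (p ^ 2 + q ^ 2) := by
  have key : (1 - (a ^ 2 + b ^ 2)) * (1 - (c ^ 2 + d ^ 2)) *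
      ((1 - (a * c + b * d)) ^ 2 + (a * d - b * c) ^ 2) =
      (1 - (p ^ 2 + q ^ 2)) ^ 2 -
      (((a + c) - ((a + c) * p + (b + d) * q)) ^ 2 +
        ((b + d) - ((a + c) * q - (b + d) * p)) ^ 2) := by
    subst hp hq; ring
  rw [key, hs, ht]; ring

lemma AB2_roots (μ : ℂ) : ∃ z w : ℂ, z + w = 1 + (3 / 2) * μ ∧ z * w = μ / 2 := by
  obtain ⟨s, hs⟩ := IsAlgClosed.exists_pow_nat_eq ((1 + (3 / 2) * μ) ^ 2 - 2 * μ) (n := 2) (by norm_num)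
  refine ⟨((1 + (3 / 2) * μ) + s) / 2, ((1 + (3 / 2) * μ) - s) / 2, by ring, ?_⟩
  linear_combination (-1 / 4) * hs

lemma AB2_root_bd (z : ℂ) (M : ℝ) (h : ∀ n : ℕ, ‖z ^ n‖ ≤ M) : ‖z‖ ≤ 1 := by
  by_contra! hz
  obtain ⟨n, hn⟩ := pow_unbounded_of_one_lt M hz
  have := h n
  rw [norm_pow] at this
  linarith

lemma AB2_bdd (z w : ℂ) (hz : ‖z‖ ≤ 1) (hw : ‖w‖ < 1) (y : ℕ → ℂ)
    (h : ∀ n : ℕ, y (n + 2) - (z + w) * y (n + 1) + (z * w) * y n = 0) :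
    ∃ M : ℝ, ∀ n : ℕ, ‖y n‖ ≤ M := by
  have h1 : ∀ n, y (n + 1) - z * y n = w ^ n * (y 1 - z * y 0) := by
    intro n
    induction n with
    | zero => simp
    | succ k ih => linear_combination h k + w * ih
  set C := ‖y 1 - z * y 0‖ with hC
  have hC0 : 0 ≤ C := norm_nonneg _
  have hq : 0 < 1 - ‖w‖ := by linarith
  have h2 : ∀ n, ‖y n‖ ≤ ‖y 0‖ + C / (1 - ‖w‖) * (1 - ‖w‖ ^ n) := by
    intro n
    induction n with
    | zero => simp
    | succ k ih =>
      have e : y (k + 1) = z * y k + w ^ k * (y 1 - z * y 0) := by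
        linear_combination h1 k
      have b1 : ‖y (k + 1)‖ ≤ ‖z‖ * ‖y k‖ + ‖w‖ ^ k * C := by
        rw [e]
        refine (norm_add_le _ _).trans ?_
        rw [norm_mul, norm_mul, norm_pow]
      have b2 : ‖z‖ * ‖y k‖ ≤ ‖y k‖ := mul_le_of_le_one_left (norm_nonneg _) hz
      have b3 : C / (1 - ‖w‖) * (1 - ‖w‖ ^ (k + 1)) =
          C / (1 - ‖w‖) * (1 - ‖w‖ ^ k) + ‖w‖ ^ k * C := by
        field_simp; ring
      linarith
  refine ⟨‖y 0‖ + C / (1 - ‖w‖), fun n => (h2 n).trans ?_⟩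
  have : 0 ≤ C / (1 - ‖w‖) := by positivity
  have h3 : 0 ≤ ‖w‖ ^ n := by positivity
  nlinarith

lemma AB2_normsq (z : ℂ) : ‖z‖ ^ 2 = z.re ^ 2 + z.im ^ 2 := by
  rw [Complex.sq_norm, Complex.normSq_apply]; ring

/-- Explicit description of the region. -/
def AB2_C (x y : ℝ) : Prop :=
  x ^ 2 + y ^ 2 < 4 / 3 ∧ (x ^ 2 + y ^ 2) ^ 2 ≤ -x * (4 - 3 * (x ^ 2 + y ^ 2))

lemma AB2_id (μ z w : ℂ) (h1 : z + w = 1 + (3 / 2) * μ) (h2 : z * w = μ / 2) :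
    (1 - ‖z‖ ^ 2) * (1 - ‖w‖ ^ 2) *
      ((1 - (z.re * w.re + z.im * w.im)) ^ 2 + (z.re * w.im - z.im * w.re) ^ 2) =
    -(1 / 2) * ((μ.re ^ 2 + μ.im ^ 2) ^ 2 + 4 * μ.re - 3 * μ.re * (μ.re ^ 2 + μ.im ^ 2)) ∧
    z.re + w.re = 1 + 3 / 2 * μ.re ∧ ‖z‖ ^ 2 * ‖w‖ ^ 2 = (μ.re ^ 2 + μ.im ^ 2) / 4 := by
  have e1 := congrArg Complex.re h1
  have e2 := congrArg Complex.im h1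
  have e3 := congrArg Complex.re h2
  have e4 := congrArg Complex.im h2
  have h2' : μ = 2 * (z * w) := by linear_combination -2 * h2
  have e5 := congrArg Complex.re h2'
  have e6 := congrArg Complex.im h2'
  have e7 : (3 / 2 * μ) = ((3 / 2 : ℝ) : ℂ) * μ := by push_cast; ring
  rw [e7] at e1 e2
  simp only [Complex.add_re, Complex.add_im, Complex.one_re, Complex.one_im,
    Complex.re_ofReal_mul, Complex.im_ofReal_mul] at e1 e2
  simp at e5 e6
  refine ⟨?_, e1, ?_⟩
  · have := AB2_identity z.re z.im w.re w.im (μ.re / 2) (μ.im / 2) (by linarith) (by linarith)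
      (by linarith) (by linarith)
    rw [AB2_normsq, AB2_normsq, this]; ring
  · rw [AB2_normsq, AB2_normsq, e5, e6]; ring

lemma AB2_fwd (μ : ℂ) (h : ∀ y : ℕ → ℂ,
      (∀ n : ℕ, y (n + 2) - (1 + (3 / 2) * μ) * y (n + 1) + (μ / 2) * y n = 0) →
      ∃ M : ℝ, ∀ n : ℕ, ‖y n‖ ≤ M) : AB2_C μ.re μ.im := by
  obtain ⟨z, w, h1, h2⟩ := AB2_roots μ
  have hz : ‖z‖ ≤ 1 := by
    obtain ⟨M, hM⟩ := h (fun n => z ^ n) (fun n => by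
      rw [← h1, ← h2]; ring)
    exact AB2_root_bd z M hM
  have hw : ‖w‖ ≤ 1 := by
    obtain ⟨M, hM⟩ := h (fun n => w ^ n) (fun n => by
      rw [← h1, ← h2]; ring)
    exact AB2_root_bd w M hM
  obtain ⟨i1, i2, i3⟩ := AB2_id μ z w h1 h2
  have hz2 : ‖z‖ ^ 2 ≤ 1 := pow_le_one₀ (norm_nonneg _) hz
  have hw2 : ‖w‖ ^ 2 ≤ 1 := pow_le_one₀ (norm_nonneg _) hw
  have hx2 : μ.re ≤ 2 / 3 := by
    have := (Complex.re_le_norm z).trans hz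
    have := (Complex.re_le_norm w).trans hw
    linarith
  have hr : (μ.re ^ 2 + μ.im ^ 2) ≤ 4 := by
    have : ‖z‖ ^ 2 * ‖w‖ ^ 2 ≤ 1 := mul_le_one₀ hz2 (by positivity) hw2
    linarith
  have hpos : 0 ≤ (1 - ‖z‖ ^ 2) * (1 - ‖w‖ ^ 2) *
      ((1 - (z.re * w.re + z.im * w.im)) ^ 2 + (z.re * w.im - z.im * w.re) ^ 2) :=
    mul_nonneg (mul_nonneg (by linarith) (by linarith)) (by positivity)
  rw [i1] at hpos
  have hxr : μ.re ^ 2 ≤ μ.re ^ 2 + μ.im ^ 2 := by nlinarith [sq_nonneg μ.im]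
  unfold AB2_C
  generalize μ.re ^ 2 + μ.im ^ 2 = r at *
  have hr0 : 0 ≤ r := le_trans (sq_nonneg _) hxr
  have hx0 : μ.re ≤ 0 := by
    by_contra! hx
    generalize μ.re = x at *
    -- `r ^ 2 + 4 x - 3 x r = (r - 3 x / 2) ^ 2 + x (4 - 9 x / 4) > 0`
    nlinarith [sq_nonneg (r - 3 * x / 2), mul_pos hx (show (0 : ℝ) < 4 - 9 * x / 4 by linarith)]
  generalize μ.re = x at *
  have hle : r ^ 2 ≤ -x * (4 - 3 * r) := by linarith
  refine ⟨?_, hle⟩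
  by_contra! hc
  have : -x * (4 - 3 * r) ≤ 0 := mul_nonpos_of_nonneg_of_nonpos (by linarith) (by linarith)
  nlinarith

lemma AB2_bwd (μ : ℂ) (h : AB2_C μ.re μ.im) : ∀ y : ℕ → ℂ,
      (∀ n : ℕ, y (n + 2) - (1 + (3 / 2) * μ) * y (n + 1) + (μ / 2) * y n = 0) →
      ∃ M : ℝ, ∀ n : ℕ, ‖y n‖ ≤ M := by
  obtain ⟨z, w, h1, h2⟩ := AB2_roots μ
  intro y hy
  rw [← h1, ← h2] at hy
  obtain ⟨i1, i2, i3⟩ := AB2_id μ z w h1 h2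
  obtain ⟨c1, c2⟩ := h
  have hpos : 0 ≤ (1 - ‖z‖ ^ 2) * (1 - ‖w‖ ^ 2) *
      ((1 - (z.re * w.re + z.im * w.im)) ^ 2 + (z.re * w.im - z.im * w.re) ^ 2) := by
    rw [i1]; linarith
  have hlt : ‖z‖ ^ 2 * ‖w‖ ^ 2 < 1 := by linarith
  have hD : 0 < (1 - (z.re * w.re + z.im * w.im)) ^ 2 + (z.re * w.im - z.im * w.re) ^ 2 := by
    by_contra! hD
    have a1 : 1 - (z.re * w.re + z.im * w.im) = 0 := by
      nlinarith [sq_nonneg (1 - (z.re * w.re + z.im * w.im)), sq_nonneg (z.re * w.im - z.im * w.re)]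
    rw [AB2_normsq, AB2_normsq] at hlt
    nlinarith [sq_nonneg (z.re * w.im - z.im * w.re)]
  have hprod : 0 ≤ (1 - ‖z‖ ^ 2) * (1 - ‖w‖ ^ 2) := nonneg_of_mul_nonneg_left hpos hD
  have hz0 := sq_nonneg ‖z‖
  have hw0 := sq_nonneg ‖w‖
  have hz1 : ‖z‖ ^ 2 ≤ 1 := by
    by_contra! hc
    nlinarith
  have hw1 : ‖w‖ ^ 2 ≤ 1 := by
    by_contra! hc
    nlinarith
  rcases lt_or_eq_of_le hw1 with hw2 | hw2
  · exact AB2_bdd z w ((sq_le_one_iff₀ (norm_nonneg _)).1 hz1)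
      ((sq_lt_one_iff₀ (norm_nonneg _)).1 hw2) y hy
  · have hz2 : ‖z‖ ^ 2 < 1 := by rw [hw2] at hlt; linarith
    exact AB2_bdd w z ((sq_le_one_iff₀ (norm_nonneg _)).1 hw1)
      ((sq_lt_one_iff₀ (norm_nonneg _)).1 hz2) y (fun n => by
        linear_combination hy n)

lemma AB2_C_convex (x y x' y' a b : ℝ) (ha : 0 ≤ a) (hb : 0 ≤ b) (hab : a + b = 1)
    (h : AB2_C x y) (h' : AB2_C x' y') : AB2_C (a * x + b * x') (a * y + b * y') := by
  obtain ⟨h1, h2⟩ := h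
  obtain ⟨h1', h2'⟩ := h'
  have hr0 : 0 ≤ (a * x + b * x') ^ 2 + (a * y + b * y') ^ 2 := by positivity
  have hr : (a * x + b * x') ^ 2 + (a * y + b * y') ^ 2 ≤
      a * (x ^ 2 + y ^ 2) + b * (x' ^ 2 + y' ^ 2) := by
    obtain rfl : b = 1 - a := by linarith
    nlinarith [mul_nonneg (mul_nonneg ha hb) (add_nonneg (sq_nonneg (x - x')) (sq_nonneg (y - y')))]
  unfold AB2_C
  generalize (a * x + b * x') ^ 2 + (a * y + b * y') ^ 2 = R at *
  generalize x ^ 2 + y ^ 2 = r at *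
  generalize x' ^ 2 + y' ^ 2 = r' at *
  have hlt : a * r + b * r' < 4 / 3 := by
    obtain rfl : b = 1 - a := by linarith
    rcases ha.eq_or_lt with rfl | ha
    · linarith
    · nlinarith
  have hR : R < 4 / 3 := by linarith
  refine ⟨hR, ?_⟩
  -- tangent line trick with slope parameter t = R / (4 - 3 R)
  have hd : 0 < 4 - 3 * R := by linarith
  obtain ⟨t, ht⟩ : ∃ t, t = R / (4 - 3 * R) := ⟨_, rfl⟩
  have ht0 : 0 ≤ t := by rw [ht]; positivity
  have htR : t * (4 - 3 * R) = R := by rw [ht]; exact div_mul_cancel₀ _ hd.ne'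
  have tang : ∀ u s : ℝ, s < 4 / 3 → s ^ 2 ≤ -u * (4 - 3 * s) →
      2 * t * s - t ^ 2 * (4 - 3 * s) ≤ -u := by
    intro u s hs hu
    have hs' : 0 < 4 - 3 * s := by linarith
    have : (2 * t * s - t ^ 2 * (4 - 3 * s)) * (4 - 3 * s) ≤ -u * (4 - 3 * s) := by
      nlinarith [sq_nonneg (s - t * (4 - 3 * s))]
    exact le_of_mul_le_mul_right this hs'
  have T1 := mul_le_mul_of_nonneg_left (tang x r h1 h2) ha
  have T2 := mul_le_mul_of_nonneg_left (tang x' r' h1' h2') hb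
  have T3 : (2 * t + 3 * t ^ 2) * R ≤ (2 * t + 3 * t ^ 2) * (a * r + b * r') :=
    mul_le_mul_of_nonneg_left hr (by positivity)
  have T4 : (2 * t + 3 * t ^ 2) * R - 4 * t ^ 2 ≤ -(a * x + b * x') := by
    have : (a + b) * t ^ 2 = t ^ 2 := by rw [hab, one_mul]
    nlinarith
  have T5 : (2 * t + 3 * t ^ 2) * R - 4 * t ^ 2 = t * R := by
    linear_combination (-t) * htR
  rw [T5] at T4
  have := mul_le_mul_of_nonneg_right T4 hd.le
  have T6 : t * R * (4 - 3 * R) = R ^ 2 := by linear_combination R * htR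
  linarith

/-- The region of absolute stability of the 2-step Adams–Bashforth method is convex. -/
theorem AB2_stability_region_convex :
    Convex ℝ {μ : ℂ | ∀ y : ℕ → ℂ,
      (∀ n : ℕ, y (n + 2) - (1 + (3 / 2) * μ) * y (n + 1) + (μ / 2) * y n = 0) →
      ∃ M : ℝ, ∀ n : ℕ, ‖y n‖ ≤ M} := by
  intro μ hμ ν hν a b ha hb hab
  apply AB2_bwd
  have := AB2_C_convex _ _ _ _ a b ha hb hab (AB2_fwd μ hμ) (AB2_fwd ν hν)
  simpa using this
end

section
/- The region of absolute stability of the 2-step Adams–Moulton method, namely the set S := {μ ∈ ℂ : 1 − (5/12)μ ≠ 0 and every complex sequence (y_n) satisfying (1 − (5/12)μ)·y_{n+2} − (1 + (2/3)μ)·y_{n+1} + (μ/12)·y_n = 0 for all n is bounded}, is a convex subset of ℂ. -/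
/-- Real description of the stability region. -/
def AM2R (x y : ℝ) : Prop :=
  x ≤ 0 ∧ (x ^ 2 + y ^ 2 + x) ^ 2 ≤ 21 * x ^ 2 - 24 * x

lemma AM2R_iff (x y : ℝ) :
    AM2R x y ↔ x ≤ 0 ∧ x ^ 2 + y ^ 2 + x ≤ Real.sqrt (21 * x ^ 2 - 24 * x) := by
  unfold AM2R
  constructor
  · rintro ⟨h1, h2⟩
    exact ⟨h1, Real.le_sqrt_of_sq_le h2⟩
  · rintro ⟨h1, h2⟩
    refine ⟨h1, ?_⟩
    have hQ : 0 ≤ 21 * x ^ 2 - 24 * x := by nlinarith [sq_nonneg x]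
    have hs := Real.sq_sqrt hQ
    have hs0 := Real.sqrt_nonneg (21 * x ^ 2 - 24 * x)
    have hx : -x ≤ Real.sqrt (21 * x ^ 2 - 24 * x) := by
      apply Real.le_sqrt_of_sq_le
      nlinarith [sq_nonneg x]
    have : -Real.sqrt (21 * x ^ 2 - 24 * x) ≤ x ^ 2 + y ^ 2 + x := by
      nlinarith [sq_nonneg x, sq_nonneg y]
    calc _ ≤ (Real.sqrt (21 * x ^ 2 - 24 * x)) ^ 2 := sq_le_sq' this h2
      _ = _ := hs

lemma AM2R_convex (x₁ y₁ x₂ y₂ s t : ℝ) (hs : 0 ≤ s) (ht : 0 ≤ t) (hst : s + t = 1)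
    (h₁ : AM2R x₁ y₁) (h₂ : AM2R x₂ y₂) : AM2R (s * x₁ + t * x₂) (s * y₁ + t * y₂) := by
  rw [AM2R_iff] at *
  obtain ⟨a1, b1⟩ := h₁
  obtain ⟨a2, b2⟩ := h₂
  have hQ1 : 0 ≤ 21 * x₁ ^ 2 - 24 * x₁ := by nlinarith [sq_nonneg x₁]
  have hQ2 : 0 ≤ 21 * x₂ ^ 2 - 24 * x₂ := by nlinarith [sq_nonneg x₂]
  have e1 := Real.sq_sqrt hQ1
  have e2 := Real.sq_sqrt hQ2
  have p1 := Real.sqrt_nonneg (21 * x₁ ^ 2 - 24 * x₁)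
  have p2 := Real.sqrt_nonneg (21 * x₂ ^ 2 - 24 * x₂)
  set g1 := Real.sqrt (21 * x₁ ^ 2 - 24 * x₁)
  set g2 := Real.sqrt (21 * x₂ ^ 2 - 24 * x₂)
  have h12 : 0 ≤ x₁ * x₂ := mul_nonneg_of_nonpos_of_nonpos a1 a2
  have hst0 : 0 ≤ s * t := mul_nonneg hs ht
  have hg : g1 * g2 ≤ 21 * (x₁ * x₂) - 12 * x₁ - 12 * x₂ := by
    refine (le_abs_self _).trans (abs_le_of_sq_le_sq ?_ (by linarith))
    rw [mul_pow, e1, e2]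
    nlinarith [sq_nonneg (x₁ - x₂)]
  have ht' : t = 1 - s := by linarith
  refine ⟨by nlinarith, ?_⟩
  have key : s * g1 + t * g2 ≤
      Real.sqrt (21 * (s * x₁ + t * x₂) ^ 2 - 24 * (s * x₁ + t * x₂)) := by
    apply Real.le_sqrt_of_sq_le
    have : 21 * (s * x₁ + t * x₂) ^ 2 - 24 * (s * x₁ + t * x₂) - (s * g1 + t * g2) ^ 2
        = 2 * (s * t) * (21 * (x₁ * x₂) - 12 * x₁ - 12 * x₂ - g1 * g2) := by
      have : (s * g1 + t * g2) ^ 2 = s ^ 2 * g1 ^ 2 + t ^ 2 * g2 ^ 2 + 2 * s * t * (g1 * g2) := by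
        ring
      rw [this, e1, e2, ht']
      ring
    have := mul_nonneg (mul_nonneg zero_le_two hst0) (sub_nonneg.2 hg)
    linarith
  have hc : ∀ u v : ℝ, (s * u + t * v) ^ 2 ≤ s * u ^ 2 + t * v ^ 2 := by
    intro u v
    have : s * u ^ 2 + t * v ^ 2 - (s * u + t * v) ^ 2 = s * t * (u - v) ^ 2 := by
      rw [ht']; ring
    have := mul_nonneg hst0 (sq_nonneg (u - v))
    linarith
  have := hc x₁ x₂
  have := hc y₁ y₂
  have := mul_le_mul_of_nonneg_left b1 hs
  have := mul_le_mul_of_nonneg_left b2 ht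
  linarith

/-- The characteristic polynomial factors. -/
lemma AM2_roots (μ : ℂ) (ha : 1 - (5 / 12) * μ ≠ 0) :
    ∃ z w : ℂ, 12 + 8 * μ = (12 - 5 * μ) * (z + w) ∧ μ = (12 - 5 * μ) * (z * w) := by
  have ha' : 12 - 5 * μ ≠ 0 := by
    intro h; apply ha; linear_combination h / 12
  obtain ⟨d, hd⟩ := IsAlgClosed.exists_pow_nat_eq
    ((12 + 8 * μ) ^ 2 - 4 * (12 - 5 * μ) * μ) (n := 2) (by norm_num)
  clear ha
  generalize 12 - 5 * μ = A at *
  refine ⟨(12 + 8 * μ + d) / (2 * A), (12 + 8 * μ - d) / (2 * A), ?_, ?_⟩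
  · field_simp; ring
  · field_simp; linear_combination hd

/-- The Schur–Cohn identities. -/
lemma AM2_ids (μ z w : ℂ) (h1 : 12 + 8 * μ = (12 - 5 * μ) * (z + w))
    (h2 : μ = (12 - 5 * μ) * (z * w)) :
    ‖12 - 5 * μ‖ ^ 2 * (1 - (‖z‖ * ‖w‖) ^ 2) = 24 * (μ.re ^ 2 + μ.im ^ 2 - 5 * μ.re + 6) ∧
    (‖12 - 5 * μ‖ ^ 2 * ‖z * ((1 - ‖w‖ ^ 2 : ℝ) : ℂ) + w * ((1 - ‖z‖ ^ 2 : ℝ) : ℂ)‖) ^ 2 =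
      24 ^ 2 * ((6 + μ.re - 2 * (μ.re ^ 2 + μ.im ^ 2)) ^ 2 + 36 * μ.im ^ 2) := by
  have n1 : ∀ v : ℂ, ‖v‖ ^ 2 = v.re ^ 2 + v.im ^ 2 := by
    intro v; rw [← Complex.normSq_eq_norm_sq, Complex.normSq_apply]; ring
  have n2 : ∀ v : ℂ, ((‖v‖ ^ 2 : ℝ) : ℂ) = v * (starRingEnd ℂ) v := by
    intro v; rw [Complex.mul_conj, Complex.normSq_eq_norm_sq]
  constructor
  · have : ‖μ‖ ^ 2 = ‖12 - 5 * μ‖ ^ 2 * (‖z‖ * ‖w‖) ^ 2 := by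
      conv_lhs => rw [h2]
      rw [norm_mul, norm_mul, mul_pow]
    rw [mul_sub, ← this, n1, n1]
    simp
    ring
  · have c1 := congrArg (starRingEnd ℂ) h1
    have c2 := congrArg (starRingEnd ℂ) h2
    simp only [map_add, map_mul, map_sub, map_ofNat] at c1 c2
    have e : ((‖12 - 5 * μ‖ ^ 2 : ℝ) : ℂ) *
        (z * ((1 - ‖w‖ ^ 2 : ℝ) : ℂ) + w * ((1 - ‖z‖ ^ 2 : ℝ) : ℂ)) =
        (12 - 5 * (starRingEnd ℂ) μ) * (12 + 8 * μ) - μ * (12 + 8 * (starRingEnd ℂ) μ) := by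
      rw [Complex.ofReal_sub, Complex.ofReal_sub, n2, n2, n2]
      simp only [map_sub, map_mul, map_ofNat, Complex.ofReal_one]
      generalize (starRingEnd ℂ) μ = m at *
      generalize (starRingEnd ℂ) z = z' at *
      generalize (starRingEnd ℂ) w = w' at *
      rw [h1, c1]
      linear_combination ((12 - 5 * m) * (z' + w')) * h2
    have e2 := congrArg (fun v : ℂ => ‖v‖ ^ 2) e
    simp only [norm_mul] at e2
    rw [Complex.norm_real, Real.norm_of_nonneg (by positivity)] at e2
    rw [e2, n1]
    simp
    ring

lemma AM2_forward (μ : ℂ) (ha : 1 - (5 / 12) * μ ≠ 0) (H : ∀ y : ℕ → ℂ,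
      (∀ n : ℕ, (1 - (5 / 12) * μ) * y (n + 2) - (1 + (2 / 3) * μ) * y (n + 1)
        + (μ / 12) * y n = 0) →
      ∃ M : ℝ, ∀ n : ℕ, ‖y n‖ ≤ M) : AM2R μ.re μ.im := by
  obtain ⟨z, w, h1, h2⟩ := AM2_roots μ ha
  have root : ∀ v : ℂ, (12 - 5 * μ) * v ^ 2 - (12 + 8 * μ) * v + μ = 0 → ‖v‖ ≤ 1 := by
    intro v hv
    obtain ⟨M, hM⟩ := H (fun n => v ^ n) (by
      intro n
      simp only [pow_add]
      linear_combination (v ^ n / 12) * hv)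
    by_contra! hlt
    obtain ⟨n, hn⟩ := pow_unbounded_of_one_lt M hlt
    have := hM n
    rw [norm_pow] at this
    linarith
  have hz : ‖z‖ ≤ 1 := root z (by linear_combination h2 - z * h1)
  have hw : ‖w‖ ≤ 1 := root w (by linear_combination h2 - w * h1)
  obtain ⟨i1, i2⟩ := AM2_ids μ z w h1 h2
  have hz0 := norm_nonneg z
  have hw0 := norm_nonneg w
  have hzw : ‖z‖ * ‖w‖ ≤ 1 := mul_le_one₀ hz hw0 hw
  have hA := sq_nonneg ‖12 - 5 * μ‖
  have tri : ‖z * ((1 - ‖w‖ ^ 2 : ℝ) : ℂ) + w * ((1 - ‖z‖ ^ 2 : ℝ) : ℂ)‖ ≤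
      1 - (‖z‖ * ‖w‖) ^ 2 := by
    refine (norm_add_le _ _).trans ?_
    rw [norm_mul, norm_mul, Complex.norm_real, Complex.norm_real,
      Real.norm_of_nonneg (by nlinarith), Real.norm_of_nonneg (by nlinarith)]
    have : 0 ≤ (1 - ‖z‖ * ‖w‖) * ((1 - ‖z‖) * (1 - ‖w‖)) :=
      mul_nonneg (by linarith) (mul_nonneg (by linarith) (by linarith))
    nlinarith
  have k1 := mul_le_mul_of_nonneg_left tri hA
  have k2 := pow_le_pow_left₀ (by positivity) k1 2
  rw [i2, i1] at k2
  have hx : μ.re ≤ 0 := by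
    by_contra! hx
    have F : (μ.re ^ 2 + μ.im ^ 2 + μ.re) ^ 2 ≤ 21 * μ.re ^ 2 - 24 * μ.re := by nlinarith
    have F1 : (μ.re ^ 2 + μ.re) ^ 2 + μ.im ^ 2 * (2 * (μ.re ^ 2 + μ.re)) ≤
        21 * μ.re ^ 2 - 24 * μ.re := by nlinarith [sq_nonneg (μ.im ^ 2)]
    have F2 : μ.re * ((μ.re - 2) ^ 2 * (μ.re + 6) + μ.im ^ 2 * (2 * (μ.re + 1))) ≤ 0 := by
      nlinarith
    have F3 : (μ.re - 2) ^ 2 * (μ.re + 6) + μ.im ^ 2 * (2 * (μ.re + 1)) ≤ 0 := by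
      by_contra! h
      have := mul_pos hx h
      linarith
    have q1 : 0 ≤ (μ.re - 2) ^ 2 * (μ.re + 6) := by positivity
    have q2 : 0 ≤ μ.im ^ 2 * (2 * (μ.re + 1)) := by positivity
    have r1 : (μ.re - 2) ^ 2 * (μ.re + 6) = 0 := by linarith
    have r2 : μ.im ^ 2 * (2 * (μ.re + 1)) = 0 := by linarith
    have s1 : μ.re = 2 := by
      rcases mul_eq_zero.1 r1 with h | h
      · have := pow_eq_zero_iff (two_ne_zero) |>.1 h
        linarith
      · linarith
    have s2 : μ.im = 0 := by
      rcases mul_eq_zero.1 r2 with h | h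
      · exact pow_eq_zero_iff (two_ne_zero) |>.1 h
      · linarith
    have hμ : μ = 2 := Complex.ext (by simp [s1]) (by simp [s2])
    have : z + w = 14 := by
      rw [hμ] at h1
      linear_combination -h1 / 2
    have h3 := norm_add_le z w
    rw [this] at h3
    norm_num at h3
    linarith
  exact ⟨hx, by nlinarith⟩

lemma AM2_bounded (z w : ℂ) (hz : ‖z‖ ≤ 1) (hw : ‖w‖ < 1) (y : ℕ → ℂ)
    (hy : ∀ n, y (n + 2) - (z + w) * y (n + 1) + z * w * y n = 0) :
    ∃ M : ℝ, ∀ n : ℕ, ‖y n‖ ≤ M := by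
  have h1 : ∀ n, y (n + 1) - z * y n = w ^ n * (y 1 - z * y 0) := by
    intro n
    induction n with
    | zero => simp
    | succ k ih => rw [pow_succ]; linear_combination hy k + w * ih
  have hw1 : 0 < 1 - ‖w‖ := by linarith
  set C := ‖y 1 - z * y 0‖
  have hC : 0 ≤ C := norm_nonneg _
  have h2 : ∀ n, ‖y n‖ ≤ ‖y 0‖ + C * ((1 - ‖w‖ ^ n) / (1 - ‖w‖)) := by
    intro n
    induction n with
    | zero => simp
    | succ k ih =>
      have : y (k + 1) = z * y k + w ^ k * (y 1 - z * y 0) := by linear_combination h1 k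
      rw [this]
      refine (norm_add_le _ _).trans ?_
      rw [norm_mul, norm_mul, norm_pow]
      have a := mul_le_of_le_one_left (norm_nonneg (y k)) hz
      have b : C * ((1 - ‖w‖ ^ (k + 1)) / (1 - ‖w‖)) =
          C * ((1 - ‖w‖ ^ k) / (1 - ‖w‖)) + ‖w‖ ^ k * C := by
        field_simp; ring
      rw [b]
      linarith
  refine ⟨‖y 0‖ + C * (1 / (1 - ‖w‖)), fun n => (h2 n).trans ?_⟩
  have : 0 ≤ ‖w‖ ^ n := by positivity
  gcongr
  linarith

lemma AM2_schur (z w : ℂ) (hzw : ‖z‖ * ‖w‖ < 1) (hle : ‖w‖ ≤ ‖z‖)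
    (h : ‖z * ((1 - ‖w‖ ^ 2 : ℝ) : ℂ) + w * ((1 - ‖z‖ ^ 2 : ℝ) : ℂ)‖ ≤
      1 - (‖z‖ * ‖w‖) ^ 2) : ‖z‖ ≤ 1 ∧ ‖w‖ < 1 := by
  have hz0 := norm_nonneg z
  have hw0 := norm_nonneg w
  have hw : ‖w‖ < 1 := by nlinarith
  refine ⟨?_, hw⟩
  by_contra! hz
  have t := norm_sub_le_norm_add (z * ((1 - ‖w‖ ^ 2 : ℝ) : ℂ)) (w * ((1 - ‖z‖ ^ 2 : ℝ) : ℂ))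
  rw [norm_mul, norm_mul, Complex.norm_real, Complex.norm_real,
      Real.norm_of_nonneg (by nlinarith), Real.norm_of_nonpos (by nlinarith)] at t
  have : 0 < (1 - ‖z‖ * ‖w‖) * ((‖z‖ - 1) * (1 - ‖w‖)) :=
      mul_pos (by linarith) (mul_pos (by linarith) (by linarith))
  nlinarith

lemma AM2_backward (μ : ℂ) (h : AM2R μ.re μ.im) : 1 - (5 / 12) * μ ≠ 0 ∧ ∀ y : ℕ → ℂ,
      (∀ n : ℕ, (1 - (5 / 12) * μ) * y (n + 2) - (1 + (2 / 3) * μ) * y (n + 1)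
        + (μ / 12) * y n = 0) →
      ∃ M : ℝ, ∀ n : ℕ, ‖y n‖ ≤ M := by
  obtain ⟨hx, hF⟩ := h
  have ha : 1 - (5 / 12) * μ ≠ 0 := by
    intro h0
    have : μ = ((12 / 5 : ℝ) : ℂ) := by push_cast; linear_combination (-12 / 5) * h0
    rw [this, Complex.ofReal_re] at hx
    norm_num at hx
  refine ⟨ha, ?_⟩
  have ha' : 12 - 5 * μ ≠ 0 := by
    intro h; apply ha; linear_combination h / 12
  obtain ⟨z, w, h1, h2⟩ := AM2_roots μ ha
  have hA : 0 < ‖12 - 5 * μ‖ ^ 2 := by positivity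
  have main : ∀ z w : ℂ, 12 + 8 * μ = (12 - 5 * μ) * (z + w) → μ = (12 - 5 * μ) * (z * w) →
      ‖w‖ ≤ ‖z‖ → ‖z‖ ≤ 1 ∧ ‖w‖ < 1 := by
    intro z w h1 h2 hle
    obtain ⟨i1, i2⟩ := AM2_ids μ z w h1 h2
    have hpos : 0 < 24 * (μ.re ^ 2 + μ.im ^ 2 - 5 * μ.re + 6) := by
      nlinarith [sq_nonneg μ.re, sq_nonneg μ.im]
    have hp : 0 < 1 - (‖z‖ * ‖w‖) ^ 2 := by
      rw [← i1] at hpos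
      exact pos_of_mul_pos_right hpos hA.le
    apply AM2_schur z w _ hle
    · apply le_of_mul_le_mul_left _ hA
      refine (le_abs_self _).trans (abs_le_of_sq_le_sq ?_ (by rw [i1]; exact hpos.le))
      rw [i2, i1]
      nlinarith
    · have : 0 ≤ ‖z‖ * ‖w‖ := by positivity
      nlinarith
  intro y hy
  have hy' : ∀ n, y (n + 2) - (z + w) * y (n + 1) + z * w * y n = 0 := by
    intro n
    apply mul_left_cancel₀ ha'
    linear_combination 12 * hy n + y (n + 1) * h1 - y n * h2
  rcases le_total ‖w‖ ‖z‖ with hle | hle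
  · obtain ⟨a, b⟩ := main z w h1 h2 hle
    exact AM2_bounded z w a b y hy'
  · obtain ⟨a, b⟩ := main w z (by rw [add_comm w z]; exact h1) (by rw [mul_comm w z]; exact h2) hle
    refine AM2_bounded w z a b y (fun n => ?_)
    linear_combination hy' n

/-- The region of absolute stability of the 2-step Adams–Moulton method is convex. -/
theorem AM2_stability_region_convex :
    Convex ℝ {μ : ℂ | 1 - (5 / 12) * μ ≠ 0 ∧ ∀ y : ℕ → ℂ,
      (∀ n : ℕ, (1 - (5 / 12) * μ) * y (n + 2) - (1 + (2 / 3) * μ) * y (n + 1)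
        + (μ / 12) * y n = 0) →
      ∃ M : ℝ, ∀ n : ℕ, ‖y n‖ ≤ M} := by
  rintro μ ⟨a1, b1⟩ ν ⟨a2, b2⟩ s t hs ht hst
  apply AM2_backward
  have := AM2R_convex _ _ _ _ s t hs ht hst (AM2_forward μ a1 b1) (AM2_forward ν a2 b2)
  simpa using this
end

section
/- The region of absolute stability of the 3-step Adams–Bashforth method, namely the set S := {μ ∈ ℂ : every complex sequence (y_n) satisfying y_{n+3} − (1 + (23/12)μ)·y_{n+2} + (4/3)μ·y_{n+1} − (5/12)μ·y_n = 0 for all n is bounded}, is not a convex subset of ℂ. -/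
theorem norm_lt_aux (z : ℂ) (r : ℝ) (hr : 0 < r) (h : Complex.normSq z < r ^ 2) : ‖z‖ < r := by
  rw [Complex.normSq_eq_norm_sq] at h
  exact lt_of_pow_lt_pow_left₀ 2 hr.le h

/-- If the characteristic polynomial factors as `(x - z)(x² + b x + c)` with `‖z‖ < 1` and
`‖b‖ + ‖c‖ ≤ 1`, all solutions are bounded. -/
theorem stable_aux (μ z b c : ℂ) (β γ : ℝ) (h2 : 1 + (23 / 12) * μ = z - b)
    (h1 : (4 / 3) * μ = c - z * b) (h0 : (5 / 12) * μ = z * c) (hz : ‖z‖ < 1)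
    (hb : ‖b‖ ≤ β) (hc : ‖c‖ ≤ γ) (hs : β + γ ≤ 1) :
    ∀ y : ℕ → ℂ,
      (∀ n : ℕ, y (n + 3) - (1 + (23 / 12) * μ) * y (n + 2)
        + (4 / 3) * μ * y (n + 1) - (5 / 12) * μ * y n = 0) →
      ∃ M : ℝ, ∀ n : ℕ, ‖y n‖ ≤ M := by
  intro y hy
  obtain ⟨w, hw⟩ : ∃ w : ℕ → ℂ, ∀ n, w n = y (n + 1) - z * y n := ⟨_, fun _ => rfl⟩
  have hrec : ∀ n, w (n + 2) = -(b * w (n + 1)) - c * w n := by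
    intro n
    have := hy n
    rw [h2, h1, h0] at this
    rw [hw, hw, hw]
    linear_combination this
  obtain ⟨W, hW0, hW1⟩ : ∃ W : ℝ, ‖w 0‖ ≤ W ∧ ‖w 1‖ ≤ W :=
    ⟨max ‖w 0‖ ‖w 1‖, le_max_left _ _, le_max_right _ _⟩
  have hWn : 0 ≤ W := (norm_nonneg _).trans hW0
  have hwb : ∀ n, ‖w n‖ ≤ W ∧ ‖w (n + 1)‖ ≤ W := by
    intro n
    induction n with
    | zero => exact ⟨hW0, hW1⟩
    | succ k ih =>
      refine ⟨ih.2, ?_⟩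
      rw [show k + 1 + 1 = k + 2 from rfl, hrec]
      calc ‖-(b * w (k + 1)) - c * w k‖ ≤ ‖-(b * w (k + 1))‖ + ‖c * w k‖ := norm_sub_le _ _
        _ = ‖b‖ * ‖w (k + 1)‖ + ‖c‖ * ‖w k‖ := by rw [norm_neg, norm_mul, norm_mul]
        _ ≤ β * W + γ * W := by
          have hβ := (norm_nonneg b).trans hb
          have hγ := (norm_nonneg c).trans hc
          gcongr
          · exact ih.2
          · exact ih.1
        _ ≤ W := by nlinarith
  have hz' : 0 < 1 - ‖z‖ := by linarith
  refine ⟨max ‖y 0‖ (W / (1 - ‖z‖)), fun n => ?_⟩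
  induction n with
  | zero => exact le_max_left _ _
  | succ k ih =>
    set M := max ‖y 0‖ (W / (1 - ‖z‖)) with hM
    have hWM : W ≤ M * (1 - ‖z‖) := (div_le_iff₀ hz').1 (le_max_right _ _)
    have e : y (k + 1) = z * y k + w k := by rw [hw]; ring
    calc ‖y (k + 1)‖ ≤ ‖z‖ * ‖y k‖ + ‖w k‖ := by
          rw [e, ← norm_mul]; exact norm_add_le _ _
      _ ≤ ‖z‖ * M + W := by
          gcongr
          exact (hwb k).1
      _ ≤ M := by linarith

/-- For positive real `μ` there is a real characteristic root larger than `1`. -/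
theorem root_aux (t : ℝ) (ht : 0 < t) : ∃ r : ℝ, 1 < r ∧
    r ^ 3 - (1 + 23 / 12 * t) * r ^ 2 + 4 / 3 * t * r - 5 / 12 * t = 0 := by
  have hc : ContinuousOn (fun r : ℝ => r ^ 3 - (1 + 23 / 12 * t) * r ^ 2 + 4 / 3 * t * r
      - 5 / 12 * t) (Set.Icc 1 (1 + 23 / 12 * t)) := by fun_prop
  have h := intermediate_value_Icc (by linarith) hc
  obtain ⟨r, hr, h0⟩ := h (show (0 : ℝ) ∈ _ from ⟨by norm_num; nlinarith, by ring_nf; nlinarith [sq_nonneg t]⟩)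
  refine ⟨r, lt_of_le_of_ne hr.1 ?_, h0⟩
  rintro rfl
  norm_num at h0
  linarith

/-- The region of absolute stability of the 3-step Adams–Bashforth method is
not convex. -/
theorem AB3_stability_region_not_convex :
    ¬ Convex ℝ {μ : ℂ | ∀ y : ℕ → ℂ,
      (∀ n : ℕ, y (n + 3) - (1 + (23 / 12) * μ) * y (n + 2)
        + (4 / 3) * μ * y (n + 1) - (5 / 12) * μ * y n = 0) →
      ∃ M : ℝ, ∀ n : ℕ, ‖y n‖ ≤ M} := by
  intro hconv
  have s1 := stable_aux (⟨14/41557, 21918/41557⟩ : ℂ) (⟨5/6, 1/2⟩ : ℂ) (⟨-6953/41557, -21231/41557⟩ : ℂ) (⟨4840/41557, 8055/41557⟩ : ℂ) (6/10) (3/10)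
    (by apply Complex.ext <;> simp <;> norm_num) (by apply Complex.ext <;> simp <;> norm_num)
    (by apply Complex.ext <;> simp <;> norm_num) (norm_lt_aux _ _ (by norm_num) (by norm_num [Complex.normSq_apply]))
    (norm_lt_aux _ _ (by norm_num) (by norm_num [Complex.normSq_apply])).le
    (norm_lt_aux _ _ (by norm_num) (by norm_num [Complex.normSq_apply])).le (by norm_num)
  have s2 := stable_aux (⟨14/41557, -21918/41557⟩ : ℂ) (⟨5/6, -1/2⟩ : ℂ) (⟨-6953/41557, 21231/41557⟩ : ℂ) (⟨4840/41557, -8055/41557⟩ : ℂ) (6/10) (3/10)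
    (by apply Complex.ext <;> simp <;> norm_num) (by apply Complex.ext <;> simp <;> norm_num)
    (by apply Complex.ext <;> simp <;> norm_num) (norm_lt_aux _ _ (by norm_num) (by norm_num [Complex.normSq_apply]))
    (norm_lt_aux _ _ (by norm_num) (by norm_num [Complex.normSq_apply])).le
    (norm_lt_aux _ _ (by norm_num) (by norm_num [Complex.normSq_apply])).le (by norm_num)
  have hm := hconv s1 s2 (show (0 : ℝ) ≤ 1 / 2 by norm_num) (show (0 : ℝ) ≤ 1 / 2 by norm_num)
    (by norm_num)
  obtain ⟨t, htd⟩ : ∃ t : ℝ, t = 14/41557 := ⟨_, rfl⟩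
  have ht : 0 < t := by rw [htd]; norm_num
  have e : (1 / 2 : ℝ) • (⟨14/41557, 21918/41557⟩ : ℂ) + (1 / 2 : ℝ) • (⟨14/41557, -21918/41557⟩ : ℂ) = (t : ℂ) := by
    rw [htd]
    apply Complex.ext <;> simp <;> norm_num
  rw [e] at hm
  obtain ⟨r, hr, h0⟩ := root_aux t ht
  have h0' : (r : ℂ) ^ 3 - (1 + 23 / 12 * t) * r ^ 2 + 4 / 3 * t * r - 5 / 12 * t = 0 := by
    have h3 := congrArg Complex.ofReal h0
    push_cast at h3
    exact h3
  obtain ⟨M, hM⟩ := hm (fun n => (r : ℂ) ^ n) (fun n => by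
    linear_combination (r : ℂ) ^ n * h0')
  obtain ⟨n, hn⟩ := pow_unbounded_of_one_lt M hr
  have := hM n
  simp only [norm_pow, Complex.norm_real, Real.norm_eq_abs, abs_of_pos (zero_lt_one.trans hr)] at this
  linarith
end
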